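/- Main Lemma (decomposition of parallel reduction): for φ-terms t, s, if t ⇛ s then there exists a φ-term r such that t →h* r and r ⇛ᵢ s, where →h* is the reflexive-transitive closure of head reduction. -/

import Mathlib

namespace PhiCalc

/-- φ-terms over a set of attribute labels `L`. An object term carries a finite
list of attributes: `(a, none)` is a void attribute, `(b, some t)` is an
attached attribute. -/
inductive Tm (L : Type) : Type where
  | loc : Nat → Tm L
  | dot : Tm L → L → Tm L
  | app : Tm L → L → Tm L → Tm L
  | obj : List (L × Option (Tm L)) → Tm L

namespace Tm

variable {L : Type}

/-- Look up a label among the attributes of an object: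
`none` = the label is missing, `some none` = void attribute,
`some (some t)` = attribute attached to `t`. -/
def lookupAttr [DecidableEq L] (a : L) : List (L × Option (Tm L)) → Option (Option (Tm L))
  | [] => none
  | (b, o) :: rest => if a = b then some o else lookupAttr a rest

/-- Attach term `u` to the (first occurrence of) label `a`. -/
def attachAttr [DecidableEq L] (a : L) (u : Tm L) :
    List (L × Option (Tm L)) → List (L × Option (Tm L))
  | [] => []
  | (b, o) :: rest => if a = b then (b, some u) :: rest else (b, o) :: attachAttr a u rest

mutual
/-- Locator increment `↑ₙ t`. -/
def incAt : Nat → Tm L → Tm L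
  | n, loc m => if m < n then loc m else loc (m + 1)
  | n, dot t a => dot (incAt n t) a
  | n, app t a u => app (incAt n t) a (incAt n u)
  | n, obj attrs => obj (incAtList (n + 1) attrs)

def incAtList : Nat → List (L × Option (Tm L)) → List (L × Option (Tm L))
  | _, [] => []
  | n, (a, none) :: rest => (a, none) :: incAtList n rest
  | n, (a, some t) :: rest => (a, some (incAt n t)) :: incAtList n rest
end

mutual
/-- Locator substitution `t[ρ^n ↦ u]`. -/
def subst : Tm L → Nat → Tm L → Tm L
  | loc m, n, u => if m < n then loc m else if m = n then u else loc (m - 1)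
  | dot t a, n, u => dot (subst t n u) a
  | app t a v, n, u => app (subst t n u) a (subst v n u)
  | obj attrs, n, u => obj (substList attrs (n + 1) (incAt 0 u))

def substList : List (L × Option (Tm L)) → Nat → Tm L → List (L × Option (Tm L))
  | [], _, _ => []
  | (a, none) :: rest, n, u => (a, none) :: substList rest n u
  | (a, some t) :: rest, n, u => (a, some (subst t n u)) :: substList rest n u
end

section Reductions

variable [DecidableEq L]

/-- One-step (regular) reduction `⇝`, parametrized by the decorator label `phi`. -/
inductive Step (phi : L) : Tm L → Tm L → Prop where
  | congObj {t t' : Tm L} (pre post : List (L × Option (Tm L))) (b : L) :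
      Step phi t t' →
      Step phi (obj (pre ++ (b, some t) :: post)) (obj (pre ++ (b, some t') :: post))
  | congDot {t t' : Tm L} (a : L) : Step phi t t' → Step phi (dot t a) (dot t' a)
  | congAppL {t t' u : Tm L} (a : L) : Step phi t t' → Step phi (app t a u) (app t' a u)
  | congAppR {t u u' : Tm L} (a : L) : Step phi u u' → Step phi (app t a u) (app t a u')
  | dotStep {attrs : List (L × Option (Tm L))} {c : L} {tc : Tm L} :
      lookupAttr c attrs = some (some tc) →
      Step phi (dot (obj attrs) c) (subst tc 0 (obj attrs))
  | dotPhi {attrs : List (L × Option (Tm L))} {c : L} :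
      lookupAttr c attrs = none → (lookupAttr phi attrs).isSome →
      Step phi (dot (obj attrs) c) (dot (dot (obj attrs) phi) c)
  | appStep {attrs : List (L × Option (Tm L))} {c : L} {u : Tm L} :
      lookupAttr c attrs = some none →
      Step phi (app (obj attrs) c u) (obj (attachAttr c (incAt 0 u) attrs))

mutual
/-- Parallel reduction `⇛`. -/
inductive Par (phi : L) : Tm L → Tm L → Prop where
  | loc (n : Nat) : Par phi (Tm.loc n) (Tm.loc n)
  | obj {attrs attrs' : List (L × Option (Tm L))} :
      ParAttrs phi attrs attrs' → Par phi (Tm.obj attrs) (Tm.obj attrs')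
  | congDot {t t' : Tm L} (a : L) : Par phi t t' → Par phi (Tm.dot t a) (Tm.dot t' a)
  | congApp {t t' u u' : Tm L} (a : L) :
      Par phi t t' → Par phi u u' → Par phi (Tm.app t a u) (Tm.app t' a u')
  | dotPar {t : Tm L} {attrs : List (L × Option (Tm L))} {c : L} {tc : Tm L} :
      Par phi t (Tm.obj attrs) → lookupAttr c attrs = some (some tc) →
      Par phi (Tm.dot t c) (subst tc 0 (Tm.obj attrs))
  | dotPhi {t : Tm L} {attrs : List (L × Option (Tm L))} {c : L} :
      Par phi t (Tm.obj attrs) → lookupAttr c attrs = none →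
      (lookupAttr phi attrs).isSome →
      Par phi (Tm.dot t c) (Tm.dot (Tm.dot (Tm.obj attrs) phi) c)
  | appPar {t : Tm L} {attrs : List (L × Option (Tm L))} {c : L} {u u' : Tm L} :
      Par phi t (Tm.obj attrs) → lookupAttr c attrs = some none → Par phi u u' →
      Par phi (Tm.app t c u) (Tm.obj (attachAttr c (incAt 0 u') attrs))

/-- Pointwise parallel reduction on attribute lists: void attributes are kept,
attached attributes reduce in parallel. -/
inductive ParAttrs (phi : L) :
    List (L × Option (Tm L)) → List (L × Option (Tm L)) → Prop where
  | nil : ParAttrs phi [] []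
  | void {rest rest' : List (L × Option (Tm L))} (a : L) :
      ParAttrs phi rest rest' → ParAttrs phi ((a, none) :: rest) ((a, none) :: rest')
  | attached {t t' : Tm L} {rest rest' : List (L × Option (Tm L))} (a : L) :
      Par phi t t' → ParAttrs phi rest rest' →
      ParAttrs phi ((a, some t) :: rest) ((a, some t') :: rest')
end

/-- Head reduction `→h`. -/
inductive Head (phi : L) : Tm L → Tm L → Prop where
  | dotStep {attrs : List (L × Option (Tm L))} {c : L} {tc : Tm L} :
      lookupAttr c attrs = some (some tc) →
      Head phi (dot (obj attrs) c) (subst tc 0 (obj attrs))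
  | dotPhi {attrs : List (L × Option (Tm L))} {c : L} :
      lookupAttr c attrs = none → (lookupAttr phi attrs).isSome →
      Head phi (dot (obj attrs) c) (dot (dot (obj attrs) phi) c)
  | appStep {attrs : List (L × Option (Tm L))} {c : L} {u : Tm L} :
      lookupAttr c attrs = some none →
      Head phi (app (obj attrs) c u) (obj (attachAttr c (incAt 0 u) attrs))
  | congDot {t t' : Tm L} (a : L) : Head phi t t' → Head phi (dot t a) (dot t' a)
  | congApp {t t' u : Tm L} (a : L) : Head phi t t' → Head phi (app t a u) (app t' a u)

/-- Internal parallel reduction `⇛ᵢ`. -/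
inductive ParI (phi : L) : Tm L → Tm L → Prop where
  | loc (n : Nat) : ParI phi (Tm.loc n) (Tm.loc n)
  | obj {attrs attrs' : List (L × Option (Tm L))} :
      ParAttrs phi attrs attrs' → ParI phi (Tm.obj attrs) (Tm.obj attrs')
  | congDot {t t' : Tm L} (a : L) : ParI phi t t' → ParI phi (Tm.dot t a) (Tm.dot t' a)
  | congApp {t t' u u' : Tm L} (a : L) :
      ParI phi t t' → Par phi u u' → ParI phi (Tm.app t a u) (Tm.app t' a u')

/-- Internal (regular) reduction `→ᵢ`. -/
inductive StepI (phi : L) : Tm L → Tm L → Prop where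
  | congObj {t t' : Tm L} (pre post : List (L × Option (Tm L))) (b : L) :
      Step phi t t' →
      StepI phi (obj (pre ++ (b, some t) :: post)) (obj (pre ++ (b, some t') :: post))
  | congDot {t t' : Tm L} (a : L) : StepI phi t t' → StepI phi (dot t a) (dot t' a)
  | congAppL {t t' u : Tm L} (a : L) : StepI phi t t' → StepI phi (app t a u) (app t' a u)
  | congAppR {t u u' : Tm L} (a : L) : Step phi u u' → StepI phi (app t a u) (app t a u')

end Reductions

end Tm

end PhiCalc
namespace PhiCalc
namespace Tm
section Extra
variable {L : Type} [DecidableEq L]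

mutual
/-- Complete development `t⁺`. -/
def cd (phi : L) : Tm L → Tm L
  | loc n => loc n
  | dot t a =>
    match cd phi t with
    | obj attrs =>
      match lookupAttr a attrs with
      | some (some ta) => subst ta 0 (obj attrs)
      | some none => dot (obj attrs) a
      | none =>
        if (lookupAttr phi attrs).isSome then dot (dot (obj attrs) phi) a
        else dot (obj attrs) a
    | t' => dot t' a
  | app t a u =>
    match cd phi t with
    | obj attrs =>
      match lookupAttr a attrs with
      | some none => obj (attachAttr a (incAt 0 (cd phi u)) attrs)
      | _ => app (obj attrs) a (cd phi u)
    | t' => app t' a (cd phi u)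
  | obj attrs => obj (cdList phi attrs)

def cdList (phi : L) : List (L × Option (Tm L)) → List (L × Option (Tm L))
  | [] => []
  | (a, none) :: rest => (a, none) :: cdList phi rest
  | (a, some t) :: rest => (a, some (cd phi t)) :: cdList phi rest
end

/-- Head reduction as a (deterministic) partial function. -/
def headRed (phi : L) : Tm L → Option (Tm L)
  | loc _ => none
  | obj _ => none
  | dot t a =>
    match t with
    | obj attrs =>
      match lookupAttr a attrs with
      | some (some ta) => some (subst ta 0 (obj attrs))
      | some none => none
      | none =>
        if (lookupAttr phi attrs).isSome then some (dot (dot (obj attrs) phi) a)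
        else none
    | t => (headRed phi t).map (fun t' => dot t' a)
  | app t a u =>
    match t with
    | obj attrs =>
      match lookupAttr a attrs with
      | some none => some (obj (attachAttr a (incAt 0 u) attrs))
      | _ => none
    | t => (headRed phi t).map (fun t' => app t' a u)

mutual
/-- Normal order reduction `⇝ℓ` as a (deterministic) partial function:
head reduction first, otherwise reduce the leftmost subterm that reduces. -/
def nordRed (phi : L) : Tm L → Option (Tm L)
  | loc _ => none
  | dot t a =>
    match headRed phi (dot t a) with
    | some s => some s
    | none => (nordRed phi t).map (fun t' => dot t' a)
  | app t a u =>
    match headRed phi (app t a u) with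
    | some s => some s
    | none =>
      match nordRed phi t with
      | some t' => some (app t' a u)
      | none => (nordRed phi u).map (fun u' => app t a u')
  | obj attrs => (nordList phi attrs).map obj

def nordList (phi : L) : List (L × Option (Tm L)) → Option (List (L × Option (Tm L)))
  | [] => none
  | (a, none) :: rest => (nordList phi rest).map (fun rest' => (a, none) :: rest')
  | (a, some t) :: rest =>
    match nordRed phi t with
    | some t' => some ((a, some t') :: rest)
    | none => (nordList phi rest).map (fun rest' => (a, some t) :: rest')
end

/-- Normal order reduction relation. -/
def NOrd (phi : L) (t t' : Tm L) : Prop := nordRed phi t = some t'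

end Extra
end Tm
end PhiCalc

namespace PhiCalc
namespace Tm

variable {L : Type}

/-! ### Commutation of increments and substitutions -/

mutual
theorem incAt_incAt (i n : Nat) (hin : i ≤ n) :
    ∀ t : Tm L, incAt (n + 1) (incAt i t) = incAt i (incAt n t)
  | loc m => by simp only [incAt]; split_ifs <;> simp only [incAt] <;> split_ifs <;> grind
  | dot t a => by simp only [incAt, incAt_incAt i n hin t]
  | app t a u => by simp only [incAt, incAt_incAt i n hin t, incAt_incAt i n hin u]
  | obj A => by simp only [incAt, incAtList_incAtList (i + 1) (n + 1) (by omega) A]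

theorem incAtList_incAtList (i n : Nat) (hin : i ≤ n) :
    ∀ A : List (L × Option (Tm L)),
      incAtList (n + 1) (incAtList i A) = incAtList i (incAtList n A)
  | [] => by simp only [incAtList]
  | (a, none) :: A => by simp only [incAtList, incAtList_incAtList i n hin A]
  | (a, some t) :: A => by
    simp only [incAtList, incAtList_incAtList i n hin A, incAt_incAt i n hin t]
end

mutual
theorem subst_incAt_self (k : Nat) (u : Tm L) : ∀ t : Tm L, subst (incAt k t) k u = t
  | loc m => by simp only [incAt]; split_ifs <;> simp only [subst] <;> split_ifs <;> grind
  | dot t a => by simp only [incAt, subst, subst_incAt_self k u t]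
  | app t a v => by simp only [incAt, subst, subst_incAt_self k u t, subst_incAt_self k u v]
  | obj A => by simp only [incAt, subst, substList_incAtList_self (k + 1) (incAt 0 u) A]

theorem substList_incAtList_self (k : Nat) (u : Tm L) :
    ∀ A : List (L × Option (Tm L)), substList (incAtList k A) k u = A
  | [] => by simp only [incAtList, substList]
  | (a, none) :: A => by simp only [incAtList, substList, substList_incAtList_self k u A]
  | (a, some t) :: A => by
    simp only [incAtList, substList, substList_incAtList_self k u A, subst_incAt_self k u t]
end

mutual
/-- Incrementing above the substituted locator. -/
theorem incAt_subst (k n : Nat) (hkn : k ≤ n) (u : Tm L) :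
    ∀ t : Tm L, incAt n (subst t k u) = subst (incAt (n + 1) t) k (incAt n u)
  | loc m => by
    simp only [incAt, subst]
    split_ifs <;> simp only [incAt, subst] <;> split_ifs <;> grind
  | dot t a => by simp only [incAt, subst, incAt_subst k n hkn u t]
  | app t a v => by simp only [incAt, subst, incAt_subst k n hkn u t, incAt_subst k n hkn u v]
  | obj A => by
    simp only [incAt, subst, incAtList_substList (k + 1) (n + 1) (by omega) (incAt 0 u) A,
      incAt_incAt 0 n (Nat.zero_le n) u]

theorem incAtList_substList (k n : Nat) (hkn : k ≤ n) (u : Tm L) :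
    ∀ A : List (L × Option (Tm L)),
      incAtList n (substList A k u) = substList (incAtList (n + 1) A) k (incAt n u)
  | [] => by simp only [incAtList, substList]
  | (a, none) :: A => by simp only [incAtList, substList, incAtList_substList k n hkn u A]
  | (a, some t) :: A => by
    simp only [incAtList, substList, incAtList_substList k n hkn u A, incAt_subst k n hkn u t]
end

mutual
/-- Incrementing below the substituted locator. -/
theorem subst_incAt (i n : Nat) (hin : i ≤ n) (u : Tm L) :
    ∀ t : Tm L, subst (incAt i t) (n + 1) (incAt i u) = incAt i (subst t n u)
  | loc m => by
    simp only [incAt, subst]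
    split_ifs <;> simp only [incAt, subst] <;> split_ifs <;> grind
  | dot t a => by simp only [incAt, subst, subst_incAt i n hin u t]
  | app t a v => by simp only [incAt, subst, subst_incAt i n hin u t, subst_incAt i n hin u v]
  | obj A => by
    simp only [incAt, subst, ← incAt_incAt 0 i (Nat.zero_le i) u,
      substList_incAtList (i + 1) (n + 1) (by omega) (incAt 0 u) A]

theorem substList_incAtList (i n : Nat) (hin : i ≤ n) (u : Tm L) :
    ∀ A : List (L × Option (Tm L)),
      substList (incAtList i A) (n + 1) (incAt i u) = incAtList i (substList A n u)
  | [] => by simp only [incAtList, substList]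
  | (a, none) :: A => by simp only [incAtList, substList, substList_incAtList i n hin u A]
  | (a, some t) :: A => by
    simp only [incAtList, substList, substList_incAtList i n hin u A, subst_incAt i n hin u t]
end

mutual
theorem subst_subst (i n : Nat) (hin : i ≤ n) (v u : Tm L) :
    ∀ t : Tm L,
      subst (subst t i v) n u = subst (subst t (n + 1) (incAt i u)) i (subst v n u)
  | loc m => by
    obtain h | rfl | h := Nat.lt_trichotomy m i
    · simp [subst, h, h.trans_le hin, (h.trans_le hin).trans (Nat.lt_succ_self n)]
    · simp [subst, Nat.lt_succ_of_le hin]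
    · obtain ⟨m, rfl⟩ := Nat.exists_eq_succ_of_ne_zero (Nat.ne_zero_of_lt h)
      obtain hm | rfl | hm := Nat.lt_trichotomy m n
      · simp [subst, hm, h.not_gt, h.ne']
      · simp [subst, subst_incAt_self, h.not_gt, h.ne']
      · have : i < m := hin.trans_lt hm
        simp [subst, h.not_gt, h.ne', hm.not_gt, hm.ne', this.not_gt, this.ne']
  | dot t a => by simp only [subst, subst_subst i n hin v u t]
  | app t a w => by simp only [subst, subst_subst i n hin v u t, subst_subst i n hin v u w]
  | obj A => by
    simp only [subst, substList_substList (i + 1) (n + 1) (by omega) (incAt 0 v) (incAt 0 u) A,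
      subst_incAt 0 n (Nat.zero_le n) u v, incAt_incAt 0 i (Nat.zero_le i) u]

theorem substList_substList (i n : Nat) (hin : i ≤ n) (v u : Tm L) :
    ∀ A : List (L × Option (Tm L)),
      substList (substList A i v) n u =
        substList (substList A (n + 1) (incAt i u)) i (subst v n u)
  | [] => by simp only [substList]
  | (a, none) :: A => by simp only [substList, substList_substList i n hin v u A]
  | (a, some t) :: A => by
    simp only [substList, substList_substList i n hin v u A, subst_subst i n hin v u t]
end

/-! ### Attribute lookup and attachment -/

section Attributes

variable [DecidableEq L]

theorem lookupAttr_incAtList (c : L) (n : Nat) :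
    ∀ A : List (L × Option (Tm L)),
      lookupAttr c (incAtList n A) = (lookupAttr c A).map (Option.map (incAt n))
  | [] => by simp [incAtList, lookupAttr]
  | (b, none) :: A => by
    simp only [incAtList, lookupAttr, lookupAttr_incAtList c n A]; split_ifs <;> simp
  | (b, some t) :: A => by
    simp only [incAtList, lookupAttr, lookupAttr_incAtList c n A]; split_ifs <;> simp

theorem lookupAttr_substList (c : L) (n : Nat) (u : Tm L) :
    ∀ A : List (L × Option (Tm L)),
      lookupAttr c (substList A n u) =
        (lookupAttr c A).map (Option.map fun t => subst t n u)
  | [] => by simp [substList, lookupAttr]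
  | (b, none) :: A => by
    simp only [substList, lookupAttr, lookupAttr_substList c n u A]; split_ifs <;> simp
  | (b, some t) :: A => by
    simp only [substList, lookupAttr, lookupAttr_substList c n u A]; split_ifs <;> simp

theorem incAtList_attachAttr (c : L) (n : Nat) (v : Tm L) :
    ∀ A : List (L × Option (Tm L)),
      incAtList n (attachAttr c v A) = attachAttr c (incAt n v) (incAtList n A)
  | [] => by simp only [incAtList, attachAttr]
  | (b, none) :: A => by
    simp only [incAtList, attachAttr]
    split_ifs <;> simp only [incAtList, incAtList_attachAttr c n v A]
  | (b, some t) :: A => by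
    simp only [incAtList, attachAttr]
    split_ifs <;> simp only [incAtList, incAtList_attachAttr c n v A]

theorem substList_attachAttr (c : L) (n : Nat) (u v : Tm L) :
    ∀ A : List (L × Option (Tm L)),
      substList (attachAttr c v A) n u = attachAttr c (subst v n u) (substList A n u)
  | [] => by simp only [substList, attachAttr]
  | (b, none) :: A => by
    simp only [substList, attachAttr]
    split_ifs <;> simp only [substList, substList_attachAttr c n u v A]
  | (b, some t) :: A => by
    simp only [substList, attachAttr]
    split_ifs <;> simp only [substList, substList_attachAttr c n u v A]

end Attributes

variable [DecidableEq L] {phi : L}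

/-! ### Head reduction is stable under increment and substitution -/

theorem Head.incAt {t t' : Tm L} (h : Head phi t t') (n : Nat) :
    Head phi (t.incAt n) (t'.incAt n) := by
  induction h with
  | @dotStep A c tc hc =>
    rw [incAt_subst 0 n (Nat.zero_le n)]
    simp only [Tm.incAt]
    exact .dotStep (by simp [lookupAttr_incAtList, hc])
  | dotPhi hc hphi =>
    simp only [Tm.incAt]
    exact .dotPhi (by simp [lookupAttr_incAtList, hc]) (by simpa [lookupAttr_incAtList] using hphi)
  | appStep hc =>
    simp only [Tm.incAt, incAtList_attachAttr, incAt_incAt 0 n (Nat.zero_le n)]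
    exact .appStep (by simp [lookupAttr_incAtList, hc])
  | congDot a _ ih => simpa only [Tm.incAt] using ih.congDot a
  | congApp a _ ih => simpa only [Tm.incAt] using ih.congApp a

theorem Head.subst {t t' : Tm L} (h : Head phi t t') (n : Nat) (u : Tm L) :
    Head phi (t.subst n u) (t'.subst n u) := by
  induction h with
  | dotStep hc =>
    rw [subst_subst 0 n (Nat.zero_le n)]
    simp only [Tm.subst]
    exact .dotStep (by simp [lookupAttr_substList, hc])
  | dotPhi hc hphi =>
    simp only [Tm.subst]
    exact .dotPhi (by simp [lookupAttr_substList, hc])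
      (by simpa [lookupAttr_substList] using hphi)
  | appStep hc =>
    simp only [Tm.subst, substList_attachAttr, subst_incAt 0 n (Nat.zero_le n)]
    exact .appStep (by simp [lookupAttr_substList, hc])
  | congDot a _ ih => simpa only [Tm.subst] using ih.congDot a
  | congApp a _ ih => simpa only [Tm.subst] using ih.congApp a

open Relation (ReflTransGen)

/-! ### Parallel reduction is stable under increment and substitution -/

mutual
theorem Par.refl : ∀ t : Tm L, Par phi t t
  | .loc n => .loc n
  | .dot t a => .congDot a (Par.refl t)
  | .app t a u => .congApp a (Par.refl t) (Par.refl u)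
  | .obj A => .obj (ParAttrs.refl A)

theorem ParAttrs.refl : ∀ A : List (L × Option (Tm L)), ParAttrs phi A A
  | [] => .nil
  | (a, none) :: A => .void a (ParAttrs.refl A)
  | (a, some t) :: A => .attached a (Par.refl t) (ParAttrs.refl A)
end

mutual
theorem Par.incAt {t t' : Tm L} (n : Nat) : Par phi t t' → Par phi (t.incAt n) (t'.incAt n)
  | .loc m => .refl _
  | .obj h => by simpa only [Tm.incAt] using .obj (h.incAtList (n + 1))
  | .congDot a h => by simpa only [Tm.incAt] using (h.incAt n).congDot a
  | .congApp a h hu => by simpa only [Tm.incAt] using (h.incAt n).congApp a (hu.incAt n)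
  | .dotPar h hc => by
    have h' := h.incAt n
    rw [incAt_subst 0 n (Nat.zero_le n)]
    simp only [Tm.incAt] at h' ⊢
    exact .dotPar h' (by simp [lookupAttr_incAtList, hc])
  | .dotPhi h hc hphi => by
    have h' := h.incAt n
    simp only [Tm.incAt] at h' ⊢
    exact .dotPhi h' (by simp [lookupAttr_incAtList, hc])
      (by simpa [lookupAttr_incAtList] using hphi)
  | .appPar h hc hu => by
    have h' := h.incAt n
    simp only [Tm.incAt, incAtList_attachAttr, incAt_incAt 0 n (Nat.zero_le n)] at h' ⊢
    exact .appPar h' (by simp [lookupAttr_incAtList, hc]) (hu.incAt n)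

theorem ParAttrs.incAtList {A A' : List (L × Option (Tm L))} (n : Nat) :
    ParAttrs phi A A' → ParAttrs phi (Tm.incAtList n A) (Tm.incAtList n A')
  | .nil => .refl _
  | .void a h => by simpa only [Tm.incAtList] using (h.incAtList n).void a
  | .attached a ht h => by
    simpa only [Tm.incAtList] using (h.incAtList n).attached a (ht.incAt n)
end

mutual
theorem Par.subst {t t' u u' : Tm L} (n : Nat) (hu : Par phi u u') :
    Par phi t t' → Par phi (t.subst n u) (t'.subst n u')
  | .loc m => by
    simp only [Tm.subst]
    split_ifs
    exacts [.refl _, hu, .refl _]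
  | .obj h => by simpa only [Tm.subst] using .obj (h.substList (n + 1) (hu.incAt 0))
  | .congDot a h => by simpa only [Tm.subst] using (Par.subst n hu h).congDot a
  | .congApp a h hv => by simpa only [Tm.subst] using (Par.subst n hu h).congApp a (Par.subst n hu hv)
  | .dotPar h hc => by
    have h' := Par.subst n hu h
    rw [subst_subst 0 n (Nat.zero_le n)]
    simp only [Tm.subst] at h' ⊢
    exact .dotPar h' (by simp [lookupAttr_substList, hc])
  | .dotPhi h hc hphi => by
    have h' := Par.subst n hu h
    simp only [Tm.subst] at h' ⊢
    exact .dotPhi h' (by simp [lookupAttr_substList, hc])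
      (by simpa [lookupAttr_substList] using hphi)
  | .appPar h hc hv => by
    have h' := Par.subst n hu h
    simp only [Tm.subst, substList_attachAttr, subst_incAt 0 n (Nat.zero_le n)] at h' ⊢
    exact .appPar h' (by simp [lookupAttr_substList, hc]) (Par.subst n hu hv)

theorem ParAttrs.substList {A A' : List (L × Option (Tm L))} {u u' : Tm L} (n : Nat)
    (hu : Par phi u u') :
    ParAttrs phi A A' → ParAttrs phi (Tm.substList A n u) (Tm.substList A' n u')
  | .nil => by simpa only [Tm.substList] using .nil
  | .void a h => by simpa only [Tm.substList] using (h.substList n hu).void a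
  | .attached a ht h => by
    simpa only [Tm.substList] using (h.substList n hu).attached a (Par.subst n hu ht)
end

/-! ### Hereditarily decomposable parallel reductions -/

mutual
/-- A parallel reduction `t ⇛ s` such that `t` head-reduces to a term with the same root as `s`,
and the corresponding immediate subterms are again related in this way. -/
inductive StdPar (phi : L) : Tm L → Tm L → Prop where
  | loc {t : Tm L} {n : Nat} :
      Par phi t (Tm.loc n) → ReflTransGen (Head phi) t (Tm.loc n) → StdPar phi t (Tm.loc n)
  | obj {t : Tm L} {A A' : List (L × Option (Tm L))} :
      Par phi t (Tm.obj A') → ReflTransGen (Head phi) t (Tm.obj A) →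
      StdParAttrs phi A A' → StdPar phi t (Tm.obj A')
  | dot {t r r' : Tm L} {a : L} :
      Par phi t (Tm.dot r' a) → ReflTransGen (Head phi) t (Tm.dot r a) →
      StdPar phi r r' → StdPar phi t (Tm.dot r' a)
  | app {t r r' u u' : Tm L} {a : L} :
      Par phi t (Tm.app r' a u') → ReflTransGen (Head phi) t (Tm.app r a u) →
      StdPar phi r r' → StdPar phi u u' → StdPar phi t (Tm.app r' a u')

/-- Pointwise extension of `StdPar` to attribute lists. -/
inductive StdParAttrs (phi : L) :
    List (L × Option (Tm L)) → List (L × Option (Tm L)) → Prop where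
  | nil : StdParAttrs phi [] []
  | void {A A' : List (L × Option (Tm L))} (a : L) :
      StdParAttrs phi A A' → StdParAttrs phi ((a, none) :: A) ((a, none) :: A')
  | attached {t t' : Tm L} {A A' : List (L × Option (Tm L))} (a : L) :
      StdPar phi t t' → StdParAttrs phi A A' →
      StdParAttrs phi ((a, some t) :: A) ((a, some t') :: A')
end

theorem StdPar.par {t s : Tm L} (h : StdPar phi t s) : Par phi t s := by
  cases h <;> assumption

theorem StdParAttrs.parAttrs {A A' : List (L × Option (Tm L))} :
    StdParAttrs phi A A' → ParAttrs phi A A'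
  | .nil => .nil
  | .void a h => .void a h.parAttrs
  | .attached a ht h => .attached a ht.par h.parAttrs

/-- `StdPar` is closed under head expansion, as long as the result is a parallel reduction. -/
theorem StdPar.head {t t' s : Tm L} (hp : Par phi t s) (hh : ReflTransGen (Head phi) t t')
    (h : StdPar phi t' s) : StdPar phi t s := by
  cases h with
  | loc _ h => exact .loc hp (hh.trans h)
  | obj _ h hA => exact .obj hp (hh.trans h) hA
  | dot _ h hr => exact .dot hp (hh.trans h) hr
  | app _ h hr hu => exact .app hp (hh.trans h) hr hu

theorem StdPar.congDot {t s : Tm L} (h : StdPar phi t s) (a : L) :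
    StdPar phi (t.dot a) (s.dot a) :=
  .dot (h.par.congDot a) .refl h

theorem StdPar.congApp {t s u v : Tm L} (h : StdPar phi t s) (a : L) (hu : StdPar phi u v) :
    StdPar phi (t.app a u) (s.app a v) :=
  .app (h.par.congApp a hu.par) .refl h hu

theorem StdParAttrs.congObj {A A' : List (L × Option (Tm L))} (h : StdParAttrs phi A A') :
    StdPar phi (Tm.obj A) (Tm.obj A') :=
  .obj (.obj h.parAttrs) .refl h

theorem StdPar.loc_refl (n : Nat) : StdPar phi (Tm.loc n) (Tm.loc n) := .loc (.loc n) .refl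

theorem head_star_incAt {t t' : Tm L} (n : Nat) (h : ReflTransGen (Head phi) t t') :
    ReflTransGen (Head phi) (t.incAt n) (t'.incAt n) :=
  h.lift _ fun _ _ h => h.incAt n

theorem head_star_subst {t t' : Tm L} (n : Nat) (u : Tm L)
    (h : ReflTransGen (Head phi) t t') :
    ReflTransGen (Head phi) (t.subst n u) (t'.subst n u) :=
  h.lift (fun t => t.subst n u) fun _ _ h => h.subst n u

theorem head_star_dot {t t' : Tm L} (a : L) (h : ReflTransGen (Head phi) t t') :
    ReflTransGen (Head phi) (t.dot a) (t'.dot a) :=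
  h.lift (fun t => t.dot a) fun _ _ h => h.congDot a

theorem head_star_app {t t' : Tm L} (a : L) (u : Tm L) (h : ReflTransGen (Head phi) t t') :
    ReflTransGen (Head phi) (t.app a u) (t'.app a u) :=
  h.lift (fun t => t.app a u) fun _ _ h => h.congApp a

mutual
theorem StdPar.incAt {t s : Tm L} (n : Nat) :
    StdPar phi t s → StdPar phi (t.incAt n) (s.incAt n)
  | .loc hp hh => by
    refine .head (hp.incAt n) (head_star_incAt n hh) ?_
    simp only [Tm.incAt]
    split_ifs <;> exact .loc_refl _
  | .obj hp hh hA => by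
    refine .head (hp.incAt n) (head_star_incAt n hh) ?_
    simpa only [Tm.incAt] using (hA.incAtList (n + 1)).congObj
  | .dot hp hh hr => by
    refine .head (hp.incAt n) (head_star_incAt n hh) ?_
    simpa only [Tm.incAt] using (hr.incAt n).congDot _
  | .app hp hh hr hu => by
    refine .head (hp.incAt n) (head_star_incAt n hh) ?_
    simpa only [Tm.incAt] using (hr.incAt n).congApp _ (hu.incAt n)

theorem StdParAttrs.incAtList {A A' : List (L × Option (Tm L))} (n : Nat) :
    StdParAttrs phi A A' → StdParAttrs phi (Tm.incAtList n A) (Tm.incAtList n A')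
  | .nil => by simpa only [Tm.incAtList] using .nil
  | .void a h => by simpa only [Tm.incAtList] using (h.incAtList n).void a
  | .attached a ht h => by
    simpa only [Tm.incAtList] using (h.incAtList n).attached a (ht.incAt n)
end

mutual
theorem StdPar.subst {t s u v : Tm L} (n : Nat) (hu : StdPar phi u v) :
    StdPar phi t s → StdPar phi (t.subst n u) (s.subst n v)
  | .loc hp hh => by
    refine .head (Par.subst n hu.par hp) (head_star_subst n u hh) ?_
    simp only [Tm.subst]
    split_ifs
    exacts [.loc_refl _, hu, .loc_refl _]
  | .obj hp hh hA => by
    refine .head (Par.subst n hu.par hp) (head_star_subst n u hh) ?_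
    simpa only [Tm.subst] using (hA.substList (n + 1) (hu.incAt 0)).congObj
  | .dot hp hh hr => by
    refine .head (Par.subst n hu.par hp) (head_star_subst n u hh) ?_
    simpa only [Tm.subst] using (StdPar.subst n hu hr).congDot _
  | .app hp hh hr hw => by
    refine .head (Par.subst n hu.par hp) (head_star_subst n u hh) ?_
    simpa only [Tm.subst] using (StdPar.subst n hu hr).congApp _ (StdPar.subst n hu hw)

theorem StdParAttrs.substList {A A' : List (L × Option (Tm L))} {u v : Tm L} (n : Nat)
    (hu : StdPar phi u v) :
    StdParAttrs phi A A' → StdParAttrs phi (Tm.substList A n u) (Tm.substList A' n v)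
  | .nil => by simpa only [Tm.substList] using .nil
  | .void a h => by simpa only [Tm.substList] using (h.substList n hu).void a
  | .attached a ht h => by
    simpa only [Tm.substList] using (h.substList n hu).attached a (StdPar.subst n hu ht)
end

/-- Related attribute lists have the same void and the same missing attributes, and related
attached ones. -/
theorem StdParAttrs.lookupAttr_rel {A A' : List (L × Option (Tm L))} (c : L) :
    StdParAttrs phi A A' →
      Option.Rel (Option.Rel (StdPar phi)) (lookupAttr c A) (lookupAttr c A')
  | .nil => by simpa only [lookupAttr] using .none
  | .void a h => by
    simp only [lookupAttr]
    split_ifs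
    exacts [.some .none, h.lookupAttr_rel c]
  | .attached a ht h => by
    simp only [lookupAttr]
    split_ifs
    exacts [.some (.some ht), h.lookupAttr_rel c]

theorem StdParAttrs.attachAttr {A A' : List (L × Option (Tm L))} {u u' : Tm L} (c : L)
    (hu : StdPar phi u u') :
    StdParAttrs phi A A' → StdParAttrs phi (Tm.attachAttr c u A) (Tm.attachAttr c u' A')
  | .nil => .nil
  | .void a h => by
    simp only [Tm.attachAttr]
    split_ifs
    exacts [h.attached a hu, (h.attachAttr c hu).void a]
  | .attached a ht h => by
    simp only [Tm.attachAttr]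
    split_ifs
    exacts [h.attached a hu, (h.attachAttr c hu).attached a ht]

mutual
theorem Par.stdPar {t s : Tm L} : Par phi t s → StdPar phi t s
  | .loc n => .loc_refl n
  | .obj h => h.stdParAttrs.congObj
  | .congDot a h => h.stdPar.congDot a
  | .congApp a h hu => h.stdPar.congApp a hu.stdPar
  | .dotPar (c := c) h hc => by
    cases h.stdPar with
    | @obj _ A _ _ hh hA =>
      have hrel := hA.lookupAttr_rel c
      rw [hc] at hrel
      generalize hc₀ : lookupAttr c A = o at hrel
      cases hrel with
      | some hrel =>
        cases hrel with
        | some htc =>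
          exact .head (.dotPar h hc) ((head_star_dot c hh).tail (.dotStep hc₀))
            (hA.congObj.subst 0 htc)
  | .dotPhi (c := c) h hc hphi => by
    cases h.stdPar with
    | @obj _ A _ _ hh hA =>
      have hc₀ : lookupAttr c A = none := by
        have hrel := hA.lookupAttr_rel c
        rw [hc] at hrel
        generalize lookupAttr c A = o at hrel
        cases hrel; rfl
      have hphi₀ : (lookupAttr phi A).isSome := by
        have hrel := hA.lookupAttr_rel phi
        obtain ⟨o', ho'⟩ := Option.isSome_iff_exists.mp hphi
        rw [ho'] at hrel
        generalize lookupAttr phi A = o at hrel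
        cases hrel; rfl
      exact .head (.dotPhi h hc hphi) ((head_star_dot c hh).tail (.dotPhi hc₀ hphi₀))
        ((hA.congObj.congDot phi).congDot c)
  | .appPar (c := c) (u := u) h hc hu => by
    cases h.stdPar with
    | @obj _ A _ _ hh hA =>
      have hc₀ : lookupAttr c A = some none := by
        have hrel := hA.lookupAttr_rel c
        rw [hc] at hrel
        generalize lookupAttr c A = o at hrel
        cases hrel with
        | some hrel => cases hrel; rfl
      exact .head (.appPar h hc hu) ((head_star_app c u hh).tail (.appStep hc₀))
        (hA.attachAttr c (hu.stdPar.incAt 0)).congObj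

theorem ParAttrs.stdParAttrs {A A' : List (L × Option (Tm L))} :
    ParAttrs phi A A' → StdParAttrs phi A A'
  | .nil => .nil
  | .void a h => h.stdParAttrs.void a
  | .attached a ht h => h.stdParAttrs.attached a ht.stdPar
end

theorem StdPar.exists_head_parI {t s : Tm L} :
    StdPar phi t s → ∃ r : Tm L, ReflTransGen (Head phi) t r ∧ ParI phi r s
  | .loc _ hh => ⟨_, hh, .loc _⟩
  | .obj _ hh hA => ⟨_, hh, .obj hA.parAttrs⟩
  | .dot (a := a) _ hh hr =>
    have ⟨_, hq, hi⟩ := hr.exists_head_parI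
    ⟨_, hh.trans (head_star_dot a hq), hi.congDot a⟩
  | .app (a := a) (u := u) _ hh hr hu =>
    have ⟨_, hq, hi⟩ := hr.exists_head_parI
    ⟨_, hh.trans (head_star_app a u hq), hi.congApp a hu.par⟩

end Tm
end PhiCalc

open PhiCalc Tm in
/-- Main Lemma (decomposition of parallel reduction): if `t ⇛ s` then
`t →h* r ⇛ᵢ s` for some `r`. -/
theorem par_decompose {L : Type} [DecidableEq L] (phi : L) {t s : Tm L}
    (h : Par phi t s) :
    ∃ r : Tm L, Relation.ReflTransGen (Head phi) t r ∧ ParI phi r s := by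
  exact h.stdPar.exists_head_parI
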